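/- Under the standing assumptions with b > 0, let ε > 0, let v_0 : X → ℝ be Borel-measurable with finite ‖·‖_ξ-norm, define v_j := T^j v_0 for j ≥ 0, let v* be Borel-measurable with finite ‖·‖_ξ-norm satisfying T v* = v* and ‖v_0 − v*‖_ξ ≤ b/(1−τ), let π̂ : X → U be Borel-measurable with π̂(x) ∈ U(x) and T^π̂ v_k = T v_k (pointwise), and let v^π̂ be Borel-measurable with finite ‖·‖_ξ-norm satisfying T^π̂ v^π̂ = v^π̂. If the number of iterations k satisfies k > [log((1−τ)² ε) − log(2bτ)] / log τ, where τ := αβ ∈ (0,1), then ‖v^π̂ − v*‖_ξ < ε, i.e., π̂ is an ε-optimal policy. -/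

import Mathlib

open MeasureTheory

/-- The weighted sup-norm `‖g‖_ξ := sup_x |g(x)| / ξ(x)`. -/
noncomputable def wnorm {X : Type*} (ξ : X → ℝ) (g : X → ℝ) : ℝ :=
  ⨆ x, |g x| / ξ x

/-- The distributionally robust Bellman operator
`(T v)(x) := inf_{u ∈ U(x)} sup_{μ ∈ D} [ c(x,u) + α ∫ v(f(x,u,w)) μ(dw) ]`. -/
noncomputable def Tbell {X U W : Type*} [MeasurableSpace W]
    (f : X → U → W → X) (c : X → U → ℝ) (α : ℝ)
    (Uadm : X → Set U) (D : Set (Measure W)) (v : X → ℝ) (x : X) : ℝ :=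
  ⨅ u : Uadm x, ⨆ μ : D, c x u + α * ∫ w, v (f x u w) ∂(μ : Measure W)

/-- The policy Bellman operator
`(T^π v)(x) := sup_{μ ∈ D} [ c(x,π(x)) + α ∫ v(f(x,π(x),w)) μ(dw) ]`. -/
noncomputable def Tpol {X U W : Type*} [MeasurableSpace W]
    (f : X → U → W → X) (c : X → U → ℝ) (α : ℝ)
    (π : X → U) (D : Set (Measure W)) (v : X → ℝ) (x : X) : ℝ :=
  ⨆ μ : D, c x (π x) + α * ∫ w, v (f x (π x) w) ∂(μ : Measure W)

theorem abs_ciSup_sub_ciSup_le {ι : Type*} [Nonempty ι] {a a' : ι → ℝ} {M : ℝ}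
    (ha : BddAbove (Set.range a)) (ha' : BddAbove (Set.range a'))
    (h : ∀ i, |a i - a' i| ≤ M) : |(⨆ i, a i) - ⨆ i, a' i| ≤ M := by
  have h1 : (⨆ i, a i) ≤ (⨆ i, a' i) + M :=
    ciSup_le fun i => by linarith [le_ciSup ha' i, (abs_le.1 (h i)).2]
  have h2 : (⨆ i, a' i) ≤ (⨆ i, a i) + M :=
    ciSup_le fun i => by linarith [le_ciSup ha i, (abs_le.1 (h i)).1]
  exact abs_le.2 ⟨by linarith, by linarith⟩

theorem abs_ciInf_sub_ciInf_le {ι : Type*} [Nonempty ι] {a a' : ι → ℝ} {M : ℝ}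
    (ha : BddBelow (Set.range a)) (ha' : BddBelow (Set.range a'))
    (h : ∀ i, |a i - a' i| ≤ M) : |(⨅ i, a i) - ⨅ i, a' i| ≤ M := by
  have h1 : (⨅ i, a i) - M ≤ ⨅ i, a' i :=
    le_ciInf fun i => by linarith [ciInf_le ha i, (abs_le.1 (h i)).2]
  have h2 : (⨅ i, a' i) - M ≤ ⨅ i, a i :=
    le_ciInf fun i => by linarith [ciInf_le ha' i, (abs_le.1 (h i)).1]
  exact abs_le.2 ⟨by linarith, by linarith⟩

section Weighted

variable {X U W : Type*} {ξ : X → ℝ} {v v' : X → ℝ} {K K' M : ℝ}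

theorem abs_le_wnorm_mul (hξ : ∀ x, 0 < ξ x)
    (hv : BddAbove (Set.range fun x => |v x| / ξ x)) (x : X) : |v x| ≤ wnorm ξ v * ξ x :=
  (div_le_iff₀ (hξ x)).1 (le_ciSup hv x)

theorem bddAbove_abs_div (hξ : ∀ x, 0 < ξ x) (h : ∀ x, |v x| ≤ M * ξ x) :
    BddAbove (Set.range fun x => |v x| / ξ x) :=
  ⟨M, by rintro _ ⟨x, rfl⟩; exact (div_le_iff₀ (hξ x)).2 (h x)⟩

theorem bddAbove_abs_sub_div (hξ : ∀ x, 0 < ξ x)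
    (hv : BddAbove (Set.range fun x => |v x| / ξ x))
    (hv' : BddAbove (Set.range fun x => |v' x| / ξ x)) :
    BddAbove (Set.range fun x => |v x - v' x| / ξ x) :=
  bddAbove_abs_div (M := wnorm ξ v + wnorm ξ v') hξ fun x => by
    linarith [abs_sub (v x) (v' x), abs_le_wnorm_mul hξ hv x, abs_le_wnorm_mul hξ hv' x]

variable [MeasurableSpace W]

theorem abs_integral_comp_le {μ : Measure W} {g : W → X}
    (hξ : Integrable (fun w => ξ (g w)) μ) {B : ℝ} (hB : ∫ w, ξ (g w) ∂μ ≤ B)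
    (hK : 0 ≤ K) (hv : ∀ y, |v y| ≤ K * ξ y) : |∫ w, v (g w) ∂μ| ≤ K * B :=
  calc |∫ w, v (g w) ∂μ| ≤ ∫ w, K * ξ (g w) ∂μ :=
        norm_integral_le_of_norm_le (f := fun w => v (g w)) (hξ.const_mul K) (ae_of_all _ fun w => hv (g w))
    _ = K * ∫ w, ξ (g w) ∂μ := integral_const_mul _ _
    _ ≤ K * B := mul_le_mul_of_nonneg_left hB hK

variable {f : X → U → W → X} {c : X → U → ℝ} {α β b : ℝ} {D : Set (Measure W)}
  {π : X → U} {x : X}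

theorem abs_robust_cost_le (hα : 0 ≤ α) (hK : 0 ≤ K)
    (hcb : |c x (π x)| ≤ b * ξ x)
    (hξint : ∀ μ ∈ D, Integrable (fun w => ξ (f x (π x) w)) μ)
    (hξbound : ∀ μ ∈ D, ∫ w, ξ (f x (π x) w) ∂μ ≤ β * ξ x)
    (hv : ∀ y, |v y| ≤ K * ξ y) (μ : D) :
    |c x (π x) + α * ∫ w, v (f x (π x) w) ∂(μ : Measure W)|
      ≤ b * ξ x + α * (K * (β * ξ x)) := by
  refine (abs_add_le _ _).trans (add_le_add hcb ?_)
  rw [abs_mul, abs_of_nonneg hα]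
  exact mul_le_mul_of_nonneg_left
    (abs_integral_comp_le (hξint _ μ.2) (hξbound _ μ.2) hK hv) hα

theorem bddAbove_robust_cost (hα : 0 ≤ α) (hK : 0 ≤ K)
    (hcb : |c x (π x)| ≤ b * ξ x)
    (hξint : ∀ μ ∈ D, Integrable (fun w => ξ (f x (π x) w)) μ)
    (hξbound : ∀ μ ∈ D, ∫ w, ξ (f x (π x) w) ∂μ ≤ β * ξ x)
    (hv : ∀ y, |v y| ≤ K * ξ y) :
    BddAbove (Set.range fun μ : D =>
      c x (π x) + α * ∫ w, v (f x (π x) w) ∂(μ : Measure W)) :=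
  ⟨_, by
    rintro _ ⟨μ, rfl⟩
    exact (abs_le.1 (abs_robust_cost_le hα hK hcb hξint hξbound hv μ)).2⟩

theorem neg_le_Tpol (hD : D.Nonempty) (hα : 0 ≤ α) (hK : 0 ≤ K)
    (hcb : |c x (π x)| ≤ b * ξ x)
    (hξint : ∀ μ ∈ D, Integrable (fun w => ξ (f x (π x) w)) μ)
    (hξbound : ∀ μ ∈ D, ∫ w, ξ (f x (π x) w) ∂μ ≤ β * ξ x)
    (hv : ∀ y, |v y| ≤ K * ξ y) :
    -(b * ξ x + α * (K * (β * ξ x))) ≤ Tpol f c α π D v x := by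
  obtain ⟨μ, hμ⟩ := hD
  exact (abs_le.1 (abs_robust_cost_le hα hK hcb hξint hξbound hv ⟨μ, hμ⟩)).1.trans
    (le_ciSup (bddAbove_robust_cost hα hK hcb hξint hξbound hv) ⟨μ, hμ⟩)

variable [MeasurableSpace X]

theorem integrable_comp_of_abs_le_mul {μ : Measure W} {g : W → X} (hg : Measurable g)
    (hξ : Integrable (fun w => ξ (g w)) μ) (hvm : Measurable v)
    (hv : ∀ y, |v y| ≤ K * ξ y) : Integrable (fun w => v (g w)) μ :=
  (hξ.const_mul K).mono' (hvm.comp hg).aestronglyMeasurable (ae_of_all _ fun w => hv (g w))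

theorem abs_Tpol_sub_Tpol_le (hD : D.Nonempty) (hα : 0 ≤ α) (hfm : Measurable (f x (π x)))
    (hcb : |c x (π x)| ≤ b * ξ x)
    (hξint : ∀ μ ∈ D, Integrable (fun w => ξ (f x (π x) w)) μ)
    (hξbound : ∀ μ ∈ D, ∫ w, ξ (f x (π x) w) ∂μ ≤ β * ξ x)
    (hvm : Measurable v) (hv'm : Measurable v') (hK : 0 ≤ K) (hK' : 0 ≤ K') (hM : 0 ≤ M)
    (hv : ∀ y, |v y| ≤ K * ξ y) (hv' : ∀ y, |v' y| ≤ K' * ξ y)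
    (h : ∀ y, |v y - v' y| ≤ M * ξ y) :
    |Tpol f c α π D v x - Tpol f c α π D v' x| ≤ α * β * M * ξ x := by
  have := hD.to_subtype
  refine abs_ciSup_sub_ciSup_le (bddAbove_robust_cost hα hK hcb hξint hξbound hv)
    (bddAbove_robust_cost hα hK' hcb hξint hξbound hv') fun μ => ?_
  rw [add_sub_add_left_eq_sub, ← mul_sub,
    ← integral_sub (integrable_comp_of_abs_le_mul hfm (hξint _ μ.2) hvm hv)
      (integrable_comp_of_abs_le_mul hfm (hξint _ μ.2) hv'm hv'), abs_mul, abs_of_nonneg hα]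
  calc α * |∫ w, v (f x (π x) w) - v' (f x (π x) w) ∂(μ : Measure W)|
      ≤ α * (M * (β * ξ x)) := mul_le_mul_of_nonneg_left
        (abs_integral_comp_le (v := fun y => v y - v' y) (hξint _ μ.2) (hξbound _ μ.2) hM h) hα
    _ = α * β * M * ξ x := by ring

theorem abs_Tbell_sub_Tbell_le {Uadm : X → Set U} (hU : (Uadm x).Nonempty)
    (hD : D.Nonempty) (hα : 0 ≤ α) (hfm : ∀ u, Measurable (f x u))
    (hcb : ∀ u ∈ Uadm x, |c x u| ≤ b * ξ x)
    (hξint : ∀ u ∈ Uadm x, ∀ μ ∈ D, Integrable (fun w => ξ (f x u w)) μ)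
    (hξbound : ∀ u ∈ Uadm x, ∀ μ ∈ D, ∫ w, ξ (f x u w) ∂μ ≤ β * ξ x)
    (hvm : Measurable v) (hv'm : Measurable v') (hK : 0 ≤ K) (hK' : 0 ≤ K') (hM : 0 ≤ M)
    (hv : ∀ y, |v y| ≤ K * ξ y) (hv' : ∀ y, |v' y| ≤ K' * ξ y)
    (h : ∀ y, |v y - v' y| ≤ M * ξ y) :
    |Tbell f c α Uadm D v x - Tbell f c α Uadm D v' x| ≤ α * β * M * ξ x := by
  have := hU.to_subtype
  have hbdd : ∀ {g : X → ℝ} {L : ℝ}, 0 ≤ L → (∀ y, |g y| ≤ L * ξ y) →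
      BddBelow (Set.range fun u : Uadm x => Tpol f c α (fun _ => (u : U)) D g x) := by
    refine fun {g L} hL hg => ⟨-(b * ξ x + α * (L * (β * ξ x))), ?_⟩
    rintro _ ⟨u, rfl⟩
    exact neg_le_Tpol (π := fun _ => (u : U)) hD hα hL (hcb _ u.2) (hξint _ u.2)
      (hξbound _ u.2) hg
  exact abs_ciInf_sub_ciInf_le (hbdd hK hv) (hbdd hK' hv') fun u =>
    abs_Tpol_sub_Tpol_le (π := fun _ => (u : U)) hD hα (hfm _) (hcb _ u.2) (hξint _ u.2)
      (hξbound _ u.2) hvm hv'm hK hK' hM hv hv' h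

end Weighted

theorem pow_lt_of_log_div_log_lt {τ a d : ℝ} {k : ℕ} (hτ0 : 0 < τ) (hτ1 : τ < 1)
    (ha : 0 < a) (hd : 0 < d) (hk : (Real.log a - Real.log d) / Real.log τ < k) :
    τ ^ k < a / d := by
  rw [div_lt_iff_of_neg (Real.log_neg hτ0 hτ1), ← Real.log_div ha.ne' hd.ne',
    ← Real.log_pow] at hk
  exact (Real.log_lt_log_iff (pow_pos hτ0 k) (div_pos ha hd)).1 hk

/-- Proposition 2: iteration-count estimate for value iteration: with
`v_j := T^j v_0`, `‖v_0 − v*‖_ξ ≤ b/(1−τ)`, `π̂` greedy with respect to `v_k`, and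
`k > [log((1−τ)² ε) − log(2bτ)] / log τ` where `τ := αβ ∈ (0,1)`, the policy `π̂` is
`ε`-optimal: `‖v^π̂ − v*‖_ξ < ε`. -/
theorem value_iteration_epsilon_optimal
    {n m l : ℕ} (Xs : Set (Fin n → ℝ)) (Us : Set (Fin m → ℝ)) (Ws : Set (Fin l → ℝ))
    (hXs : MeasurableSet Xs) (hUs : MeasurableSet Us) (hWs : MeasurableSet Ws)
    (f : ↥Xs → ↥Us → ↥Ws → ↥Xs)
    (hf : Measurable fun q : (↥Xs × ↥Us) × ↥Ws => f q.1.1 q.1.2 q.2)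
    (c : ↥Xs → ↥Us → ℝ) (hc : Measurable fun q : ↥Xs × ↥Us => c q.1 q.2)
    (α : ℝ) (hα0 : 0 < α) (hα1 : α < 1)
    (Uadm : ↥Xs → Set ↥Us) (hUne : ∀ x, (Uadm x).Nonempty)
    (D : Set (Measure ↥Ws)) (hDne : D.Nonempty)
    (hDprob : ∀ μ ∈ D, IsProbabilityMeasure μ)
    (ξ : ↥Xs → ℝ) (hξm : Measurable ξ) (hξ1 : ∀ x, 1 ≤ ξ x)
    (b β : ℝ) (hb : 0 < b) (hβ1 : 1 ≤ β) (hβ : β < 1 / α)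
    (hcb : ∀ x, ∀ u ∈ Uadm x, |c x u| ≤ b * ξ x)
    (hξint : ∀ x, ∀ u ∈ Uadm x, ∀ μ ∈ D, Integrable (fun w => ξ (f x u w)) μ)
    (hξbound : ∀ x, ∀ u ∈ Uadm x, ∀ μ ∈ D, ∫ w, ξ (f x u w) ∂μ ≤ β * ξ x)
    (ε : ℝ) (hε : 0 < ε)
    (v0 : ↥Xs → ℝ) (hv0m : Measurable v0)
    (hv0b : BddAbove (Set.range fun x => |v0 x| / ξ x))
    -- regularity of the value-iteration iterates `v_j = T^j v_0` (ensured in the paper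
    -- by the standing semicontinuity assumptions)
    (hiter : ∀ j : ℕ, Measurable ((Tbell f c α Uadm D)^[j] v0) ∧
      BddAbove (Set.range fun x => |(Tbell f c α Uadm D)^[j] v0 x| / ξ x))
    (vstar : ↥Xs → ℝ) (hvstarm : Measurable vstar)
    (hvstarb : BddAbove (Set.range fun x => |vstar x| / ξ x))
    (hfix : ∀ x, Tbell f c α Uadm D vstar x = vstar x)
    (hinit : wnorm ξ (fun x => v0 x - vstar x) ≤ b / (1 - α * β))
    (k : ℕ)
    (πhat : ↥Xs → ↥Us) (hπm : Measurable πhat) (hπadm : ∀ x, πhat x ∈ Uadm x)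
    (hgreedy : ∀ x, Tpol f c α πhat D ((Tbell f c α Uadm D)^[k] v0) x
        = Tbell f c α Uadm D ((Tbell f c α Uadm D)^[k] v0) x)
    (vπ : ↥Xs → ℝ) (hvπm : Measurable vπ)
    (hvπb : BddAbove (Set.range fun x => |vπ x| / ξ x))
    (hfixπ : ∀ x, Tpol f c α πhat D vπ x = vπ x)
    (hk : (k : ℝ) > (Real.log ((1 - α * β) ^ 2 * ε) - Real.log (2 * b * (α * β)))
        / Real.log (α * β)) :
    wnorm ξ (fun x => vπ x - vstar x) < ε := by
  set τ := α * β with hτ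
  have hτ0 : 0 < τ := mul_pos hα0 (by linarith)
  have hτ1 : τ < 1 := by rwa [lt_div_iff₀ hα0, mul_comm] at hβ
  have h1τ : 0 < 1 - τ := sub_pos.2 hτ1
  have hξ0 : ∀ x, 0 < ξ x := fun x => one_pos.trans_le (hξ1 x)
  have hwn : ∀ g : ↥Xs → ℝ, 0 ≤ wnorm ξ g := fun g =>
    Real.iSup_nonneg fun x => div_nonneg (abs_nonneg _) (hξ0 x).le
  have hfm : ∀ x u, Measurable (f x u) := fun x u =>
    hf.comp (measurable_const (a := (x, u)).prodMk measurable_id)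
  set V : ℕ → ↥Xs → ℝ := fun j => (Tbell f c α Uadm D)^[j] v0 with hV
  have hT : ∀ j x M, 0 ≤ M → (∀ y, |V j y - vstar y| ≤ M * ξ y) →
      |Tbell f c α Uadm D (V j) x - vstar x| ≤ τ * M * ξ x := by
    intro j x M hM h
    rw [← hfix x]
    exact abs_Tbell_sub_Tbell_le (hUne x) hDne hα0.le (hfm x) (hcb x) (hξint x) (hξbound x)
      (hiter j).1 hvstarm (hwn _) (hwn _) hM (abs_le_wnorm_mul hξ0 (hiter j).2)
      (abs_le_wnorm_mul hξ0 hvstarb) h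
  set d := b / (1 - τ) with hd
  have hd0 : 0 < d := div_pos hb h1τ
  have hconv : ∀ j x, |V j x - vstar x| ≤ τ ^ j * d * ξ x := by
    intro j
    induction j with
    | zero =>
      intro x
      rw [pow_zero, one_mul]
      exact (abs_le_wnorm_mul (v := fun x => v0 x - vstar x) hξ0
        (bddAbove_abs_sub_div hξ0 hv0b hvstarb) x).trans
        (mul_le_mul_of_nonneg_right hinit (hξ0 x).le)
    | succ j ih =>
      intro x
      have h := hT j x _ (by positivity) ih
      simp only [hV, Function.iterate_succ_apply'] at h ⊢
      exact h.trans_eq (by ring)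
  set N := wnorm ξ (fun x => vπ x - vstar x) with hN
  set M := τ ^ k * d with hM
  have hM0 : 0 ≤ M := by positivity
  have hdiff : ∀ x, |vπ x - vstar x| ≤ N * ξ x :=
    abs_le_wnorm_mul hξ0 (bddAbove_abs_sub_div hξ0 hvπb hvstarb)
  have hstep : ∀ x, |vπ x - vstar x| ≤ (τ * (N + M) + τ * M) * ξ x := by
    intro x
    have hπ : |Tpol f c α πhat D vπ x - Tpol f c α πhat D (V k) x| ≤ τ * (N + M) * ξ x :=
      abs_Tpol_sub_Tpol_le hDne hα0.le (hfm x _) (hcb x _ (hπadm x)) (hξint x _ (hπadm x))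
        (hξbound x _ (hπadm x)) hvπm (hiter k).1 (hwn _) (hwn _) (add_nonneg (hwn _) hM0)
        (abs_le_wnorm_mul hξ0 hvπb) (abs_le_wnorm_mul hξ0 (hiter k).2) fun y => by
          have h1 := hconv k y
          rw [abs_sub_comm] at h1
          linarith [abs_sub_le (vπ y) (vstar y) (V k y), hdiff y]
    rw [hfixπ x, hgreedy x] at hπ
    linarith [abs_sub_le (vπ x) (Tbell f c α Uadm D (V k) x) (vstar x),
      hT k x M hM0 (hconv k)]
  have hNle : N ≤ τ * (N + M) + τ * M :=
    Real.iSup_le (fun x => (div_le_iff₀ (hξ0 x)).2 (hstep x))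
      (by have := hwn fun x => vπ x - vstar x; positivity)
  have hpow : τ ^ k < (1 - τ) ^ 2 * ε / (2 * b * τ) :=
    pow_lt_of_log_div_log_lt hτ0 hτ1 (by positivity) (by positivity) hk
  have hMlt : 2 * τ * M < (1 - τ) * ε := by
    rw [lt_div_iff₀ (by positivity)] at hpow
    rw [hM, hd, ← mul_div_assoc, ← mul_div_assoc, div_lt_iff₀ h1τ]
    linarith
  exact lt_of_mul_lt_mul_left (by linarith) h1τ.le
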